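/- arXiv:1109.5657 — 3 statements merged into one kernel-verified Lean document; each statement's English description precedes it below -/
import Mathlib

section
/- (Lemma 2.2, existence and uniqueness of the fixed point.) Assume 0<k<k_c, i.e. σ₋k²<g⟦ρ⟧. Then there exists a unique s>0 such that α(k,s)<0 and s=√(−α(k,s)); equivalently, there is exactly one s>0 with α(k,s)=−s². -/
open MeasureTheory Set

/-- Piecewise-constant coefficient on `(-b,1)`: value `vm` below the interface `{0}`,
value `vp` above. -/
noncomputable def pw (vm vp : ℝ) (x : ℝ) : ℝ := if x < 0 then vm else vp

/-- First derivative within `[-b,1]`. -/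
noncomputable def d1 (b : ℝ) (ψ : ℝ → ℝ) : ℝ → ℝ := derivWithin ψ (Set.Icc (-b) 1)

/-- Second derivative within `[-b,1]`. -/
noncomputable def d2 (b : ℝ) (ψ : ℝ → ℝ) : ℝ → ℝ := derivWithin (d1 b ψ) (Set.Icc (-b) 1)

/-- The viscous part `E1(ψ;k)` of the energy. -/
noncomputable def E1 (b μm μp k : ℝ) (ψ : ℝ → ℝ) : ℝ :=
  (1 / 2) * ∫ x in (-b)..1,
    pw μm μp x * (4 * k ^ 2 * d1 b ψ x ^ 2 + (k ^ 2 * ψ x + d2 b ψ x) ^ 2)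

/-- The boundary part `E0(ψ;k)` of the energy. -/
noncomputable def E0 (b g ρm ρp σm σp k : ℝ) (ψ : ℝ → ℝ) : ℝ :=
  k ^ 2 / 2 * (σp * k ^ 2 + g * ρp) * ψ 1 ^ 2
    + k ^ 2 / 2 * (σm * k ^ 2 - g * (ρp - ρm)) * ψ 0 ^ 2

/-- The total energy `E(ψ;k,s) = s E1(ψ;k) + E0(ψ;k)`. -/
noncomputable def En (b g ρm ρp μm μp σm σp k s : ℝ) (ψ : ℝ → ℝ) : ℝ :=
  s * E1 b μm μp k ψ + E0 b g ρm ρp σm σp k ψ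

/-- The normalization functional `J(ψ;k)`. -/
noncomputable def Jen (b ρm ρp k : ℝ) (ψ : ℝ → ℝ) : ℝ :=
  (1 / 2) * ∫ x in (-b)..1, pw ρm ρp x * (k ^ 2 * ψ x ^ 2 + d1 b ψ x ^ 2)

/-- The admissible class `𝒜`: `ψ : ℝ → ℝ` twice continuously differentiable on `[-b,1]`
with `ψ(-b) = ψ'(-b) = 0`. -/
def memA (b : ℝ) (ψ : ℝ → ℝ) : Prop :=
  ContDiffOn ℝ 2 ψ (Set.Icc (-b) 1) ∧ ψ (-b) = 0 ∧ d1 b ψ (-b) = 0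

/-- The set of energy values over the constraint class `𝒞(k) = {ψ ∈ 𝒜 : J(ψ;k) = 1}`. -/
noncomputable def enSet (b g ρm ρp μm μp σm σp k s : ℝ) : Set ℝ :=
  En b g ρm ρp μm μp σm σp k s '' {ψ : ℝ → ℝ | memA b ψ ∧ Jen b ρm ρp k ψ = 1}

/-- `α(k,s) := inf {E(ψ;k,s) : ψ ∈ 𝒞(k)}`. -/
noncomputable def alpha (b g ρm ρp μm μp σm σp k s : ℝ) : ℝ :=
  sInf (enSet b g ρm ρp μm μp σm σp k s)

lemma trace_bound (b ρm ρp k : ℝ) (hb : 0 < b) (hρm : 0 < ρm) (hρ : ρm < ρp) (hk : 0 < k)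
    (ψ : ℝ → ℝ) (h : memA b ψ) : ψ 0 ^ 2 * (k * ρm) ≤ 2 * Jen b ρm ρp k ψ := by
  obtain ⟨hC, h0, -⟩ := h
  have hud : UniqueDiffOn ℝ (Set.Icc (-b) 1) := uniqueDiffOn_Icc (by linarith)
  have hψ : ContinuousOn ψ (Set.Icc (-b) 1) := hC.continuousOn
  have hd : ContinuousOn (d1 b ψ) (Set.Icc (-b) 1) :=
    hC.continuousOn_derivWithin hud (by norm_num)
  have hsub : Set.Icc (-b) 0 ⊆ Set.Icc (-b) 1 := Set.Icc_subset_Icc_right (by norm_num)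
  have hder : ∀ x ∈ Set.Ioo (-b) 0, HasDerivAt (fun x => ψ x ^ 2) (2 * ψ x * d1 b ψ x) x := by
    intro x hx
    have hn : Set.Icc (-b) 1 ∈ nhds x := Icc_mem_nhds hx.1 (by linarith [hx.2])
    have h1 : DifferentiableWithinAt ℝ ψ (Set.Icc (-b) 1) x :=
      (hC.differentiableOn (by norm_num)) x ⟨hx.1.le, by linarith [hx.2]⟩
    have h2 : HasDerivAt ψ (d1 b ψ x) x := h1.hasDerivWithinAt.hasDerivAt hn
    exact (h2.fun_pow 2).congr_deriv (by norm_num)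
  have hi1 : IntervalIntegrable (fun x => 2 * ψ x * d1 b ψ x) volume (-b) 0 := by
    apply ContinuousOn.intervalIntegrable_of_Icc (by linarith)
    exact ((continuousOn_const.mul hψ).mul hd).mono hsub
  have hftc := intervalIntegral.integral_eq_sub_of_hasDerivAt_of_le (by linarith : -b ≤ 0)
    (f := fun x => ψ x ^ 2) ((hψ.pow 2).mono hsub) hder hi1
  have hmono : Monotone (pw ρm ρp) := by
    intro x y hxy
    unfold pw
    split_ifs <;> linarith
  have hfc : ContinuousOn (fun x => k ^ 2 * ψ x ^ 2 + d1 b ψ x ^ 2) (Set.Icc (-b) 1) :=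
    (continuousOn_const.mul (hψ.pow 2)).add (hd.pow 2)
  have hi2 : IntervalIntegrable (fun x => pw ρm ρp x * (k ^ 2 * ψ x ^ 2 + d1 b ψ x ^ 2))
      volume (-b) 1 := by
    apply IntervalIntegrable.mul_continuousOn hmono.intervalIntegrable
    rwa [Set.uIcc_of_le (by linarith)]
  have hi2a := hi2.mono_set (c := -b) (d := 0) (by
    rw [Set.uIcc_of_le (by linarith), Set.uIcc_of_le (by linarith)]; exact hsub)
  have hi2b := hi2.mono_set (c := 0) (d := 1) (by
    rw [Set.uIcc_of_le (by linarith), Set.uIcc_of_le (by linarith)]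
    exact Set.Icc_subset_Icc_left (by linarith))
  have hpw : ∀ x, ρm ≤ pw ρm ρp x := by
    intro x; unfold pw; split_ifs <;> linarith
  have hsplit := intervalIntegral.integral_add_adjacent_intervals hi2a hi2b
  have hpos : 0 ≤ ∫ x in (0:ℝ)..1, pw ρm ρp x * (k ^ 2 * ψ x ^ 2 + d1 b ψ x ^ 2) := by
    apply intervalIntegral.integral_nonneg (by norm_num)
    intro x _
    exact mul_nonneg (hρm.le.trans (hpw x)) (by positivity)
  have hle : ∫ x in (-b)..0, (k * ρm) * (2 * ψ x * d1 b ψ x) ≤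
      ∫ x in (-b)..0, pw ρm ρp x * (k ^ 2 * ψ x ^ 2 + d1 b ψ x ^ 2) := by
    apply intervalIntegral.integral_mono_on (by linarith) (hi1.const_mul _) hi2a
    intro x _
    calc (k * ρm) * (2 * ψ x * d1 b ψ x)
        ≤ ρm * (k ^ 2 * ψ x ^ 2 + d1 b ψ x ^ 2) := by
          nlinarith [mul_nonneg hρm.le (sq_nonneg (k * ψ x - d1 b ψ x))]
      _ ≤ _ := mul_le_mul_of_nonneg_right (hpw x) (by positivity)
  rw [intervalIntegral.integral_const_mul, hftc] at hle
  simp only [h0] at hle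
  unfold Jen
  linarith

lemma E1_nonneg (b μm μp k : ℝ) (hb : 0 < b) (hμm : 0 < μm) (hμp : 0 < μp) (ψ : ℝ → ℝ) :
    0 ≤ E1 b μm μp k ψ := by
  unfold E1
  refine mul_nonneg (by norm_num) (intervalIntegral.integral_nonneg (by linarith) ?_)
  intro x _
  refine mul_nonneg ?_ (by positivity)
  unfold pw; split_ifs <;> linarith

lemma Jen_smul (b ρm ρp k c : ℝ) (ψ : ℝ → ℝ) :
    Jen b ρm ρp k (fun x => c * ψ x) = c ^ 2 * Jen b ρm ρp k ψ := by
  have h : d1 b (fun x => c * ψ x) = fun x => c * d1 b ψ x := by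
    funext x
    simp [d1, derivWithin_const_mul_field]
  unfold Jen
  rw [h, mul_left_comm (c ^ 2), ← intervalIntegral.integral_const_mul (c ^ 2)]
  congr 2
  funext x
  ring

lemma memA_test (b c : ℝ) (hb : 0 < b) : memA b (fun x => c * ((x + b) ^ 2 * (1 - x))) := by
  refine ⟨?_, by simp, ?_⟩
  · apply ContDiff.contDiffOn
    fun_prop
  · unfold d1
    have h : HasDerivAt (fun x : ℝ => c * ((x + b) ^ 2 * (1 - x))) 0 (-b) := by
      have h1 : HasDerivAt (fun x : ℝ => x + b) 1 (-b) := (hasDerivAt_id _).add_const b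
      have h2 : HasDerivAt (fun x : ℝ => 1 - x) (-1) (-b) := (hasDerivAt_id _).const_sub 1
      exact (((h1.fun_pow 2).fun_mul h2).const_mul c).congr_deriv (by simp)
    exact h.hasDerivWithinAt.derivWithin
      (uniqueDiffOn_Icc (by linarith : -b < 1) _ ⟨le_refl _, by linarith⟩)

/-- Lemma 2.2: in the subcritical regime `σ₋k² < g⟦ρ⟧` there exists a unique `s > 0` with
`α(k,s) < 0` and `s = √(-α(k,s))`. -/
theorem fixed_point_exists_unique
    (b g ρm ρp μm μp σm σp k : ℝ)
    (hb : 0 < b) (hg : 0 < g) (hρm : 0 < ρm) (hρ : ρm < ρp)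
    (hμm : 0 < μm) (hμp : 0 < μp) (hσm : 0 ≤ σm) (hσp : 0 ≤ σp) (hk : 0 < k)
    (hsub : σm * k ^ 2 < g * (ρp - ρm)) :
    ∃! s : ℝ, 0 < s ∧ alpha b g ρm ρp μm μp σm σp k s < 0 ∧
      s = Real.sqrt (-(alpha b g ρm ρp μm μp σm σp k s)) := by
  set α : ℝ → ℝ := fun s => alpha b g ρm ρp μm μp σm σp k s with hα
  obtain ⟨M, hM0, hM⟩ : ∃ M : ℝ, 0 ≤ M ∧ ∀ ψ, memA b ψ → Jen b ρm ρp k ψ = 1 →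
      -M ≤ E0 b g ρm ρp σm σp k ψ := by
    have hkρ : 0 < k * ρm := mul_pos hk hρm
    have hA : 0 ≤ k ^ 2 / 2 * (g * (ρp - ρm) - σm * k ^ 2) :=
      mul_nonneg (by positivity) (by linarith)
    refine ⟨k ^ 2 / 2 * (g * (ρp - ρm) - σm * k ^ 2) * (2 / (k * ρm)),
      mul_nonneg hA (by positivity), ?_⟩
    intro ψ hψ hJ
    have h1 := trace_bound b ρm ρp k hb hρm hρ hk ψ hψ
    rw [hJ, mul_one] at h1
    have h2 : ψ 0 ^ 2 ≤ 2 / (k * ρm) := by rwa [le_div_iff₀ hkρ]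
    have h3 := mul_le_mul_of_nonneg_left h2 hA
    have hρp : 0 < ρp := hρm.trans hρ
    have h4 : 0 ≤ k ^ 2 / 2 * (σp * k ^ 2 + g * ρp) * ψ 1 ^ 2 := by positivity
    unfold E0
    linarith
  have hE1 := fun ψ => E1_nonneg b μm μp k hb hμm hμp ψ
  have hlow : ∀ s, 0 < s → ∀ y ∈ enSet b g ρm ρp μm μp σm σp k s, -M ≤ y := by
    rintro s hs _ ⟨ψ, ⟨hψ, hJ⟩, rfl⟩
    have := mul_nonneg hs.le (hE1 ψ)
    unfold En
    linarith [hM ψ hψ hJ]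
  have hbdd : ∀ s, 0 < s → BddBelow (enSet b g ρm ρp μm μp σm σp k s) :=
    fun s hs => ⟨-M, fun y hy => hlow s hs y hy⟩
  obtain ⟨ψ₀, hψ₀, hJ₀, hneg⟩ : ∃ ψ, memA b ψ ∧ Jen b ρm ρp k ψ = 1 ∧
      E0 b g ρm ρp σm σp k ψ < 0 := by
    have h1 := memA_test b 1 hb
    have h2 := trace_bound b ρm ρp k hb hρm hρ hk _ h1
    rw [Jen_smul] at h2
    set J := Jen b ρm ρp k (fun x => (x + b) ^ 2 * (1 - x)) with hJ
    have hJpos : 0 < J := by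
      have : 0 < (1 * ((0 + b) ^ 2 * (1 - 0))) ^ 2 * (k * ρm) := by
        simp only [zero_add, sub_zero]; positivity
      linarith
    refine ⟨_, memA_test b (√J)⁻¹ hb, ?_, ?_⟩
    · rw [Jen_smul, ← hJ, inv_pow, Real.sq_sqrt hJpos.le, inv_mul_cancel₀ hJpos.ne']
    · have hc : 0 < (√J)⁻¹ := by positivity
      have : 0 < k ^ 2 / 2 * (g * (ρp - ρm) - σm * k ^ 2) * ((√J)⁻¹ * b ^ 2) ^ 2 := by
        have : 0 < g * (ρp - ρm) - σm * k ^ 2 := by linarith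
        positivity
      unfold E0
      simp only [sub_self, mul_zero, zero_add, sub_zero, mul_one]
      nlinarith
  have hle : ∀ s, 0 < s → ∀ ψ, memA b ψ → Jen b ρm ρp k ψ = 1 →
      α s ≤ s * E1 b μm μp k ψ + E0 b g ρm ρp σm σp k ψ :=
    fun s hs ψ hψ hJ => csInf_le (hbdd s hs) ⟨ψ, ⟨hψ, hJ⟩, rfl⟩
  have hge : ∀ s y, (∀ ψ, memA b ψ → Jen b ρm ρp k ψ = 1 →
      y ≤ s * E1 b μm μp k ψ + E0 b g ρm ρp σm σp k ψ) → y ≤ α s := by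
    intro s y h
    apply le_csInf
    · exact ⟨_, ψ₀, ⟨hψ₀, hJ₀⟩, rfl⟩
    · rintro _ ⟨ψ, ⟨hψ, hJ⟩, rfl⟩
      exact h ψ hψ hJ
  have hmono : ∀ s t, 0 < s → s ≤ t → α s ≤ α t := by
    intro s t hs hst
    apply hge
    intro ψ hψ hJ
    have := mul_le_mul_of_nonneg_right hst (hE1 ψ)
    linarith [hle s hs ψ hψ hJ]
  have hconc : ConcaveOn ℝ (Set.Ioi 0) α := by
    refine ⟨convex_Ioi 0, ?_⟩
    intro s hs t ht p q hp hq hpq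
    simp only [smul_eq_mul]
    apply hge
    intro ψ hψ hJ
    have h1 := mul_le_mul_of_nonneg_left (hle s hs ψ hψ hJ) hp
    have h2 := mul_le_mul_of_nonneg_left (hle t ht ψ hψ hJ) hq
    calc _ ≤ _ := add_le_add h1 h2
      _ = (p * s + q * t) * E1 b μm μp k ψ + (p + q) * E0 b g ρm ρp σm σp k ψ := by ring
      _ = _ := by rw [hpq, one_mul]
  have hcont : ContinuousOn α (Set.Ioi 0) := hconc.continuousOn isOpen_Ioi
  have hkey : ∀ s, 0 < s → ((α s < 0 ∧ s = Real.sqrt (-(α s))) ↔ α s + s ^ 2 = 0) := by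
    intro s hs
    constructor
    · rintro ⟨h1, h2⟩
      have h3 := Real.sq_sqrt (by linarith : 0 ≤ -(α s))
      rw [← h2] at h3
      linarith
    · intro h
      have : 0 < s ^ 2 := by positivity
      refine ⟨by linarith, ?_⟩
      rw [show -(α s) = s ^ 2 by linarith, Real.sqrt_sq hs.le]
  -- existence
  obtain ⟨s₀, hs₀, hs₀'⟩ : ∃ s, 0 < s ∧ α s + s ^ 2 = 0 := by
    set A := E1 b μm μp k ψ₀
    set B := E0 b g ρm ρp σm σp k ψ₀
    have hA : 0 ≤ A := hE1 ψ₀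
    set t := min 1 (-B / (2 * (A + 1))) with ht
    have hBp : 0 < -B := by linarith
    have ht0 : 0 < t := lt_min one_pos (by positivity)
    have ht1 : t ≤ 1 := min_le_left _ _
    have ht2 : t * (2 * (A + 1)) ≤ -B := by
      rw [← le_div_iff₀ (by positivity)]; exact min_le_right _ _
    have hlo : α t + t ^ 2 ≤ 0 := by
      have := hle t ht0 ψ₀ hψ₀ hJ₀
      nlinarith
    have hhi : 0 ≤ α (M + 1) + (M + 1) ^ 2 := by
      have : -M ≤ α (M + 1) := hge _ _ (fun ψ hψ hJ => by
        have := mul_nonneg (by linarith : 0 ≤ M + 1) (hE1 ψ)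
        linarith [hM ψ hψ hJ])
      nlinarith
    have hc : ContinuousOn (fun s => α s + s ^ 2) (Set.Icc t (M + 1)) :=
      (hcont.mono (fun x hx => ht0.trans_le hx.1)).add (continuousOn_id.pow 2)
    obtain ⟨s, hs, hs'⟩ := intermediate_value_Icc (by linarith : t ≤ M + 1) hc ⟨hlo, hhi⟩
    exact ⟨s, ht0.trans_le hs.1, hs'⟩
  refine ⟨s₀, ⟨hs₀, (hkey s₀ hs₀).2 hs₀'⟩, ?_⟩
  rintro s ⟨hs, h⟩
  have hs' := (hkey s hs).1 h
  rcases lt_trichotomy s s₀ with h | h | h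
  · nlinarith [hmono s s₀ hs h.le]
  · exact h
  · nlinarith [hmono s₀ s hs₀ h.le]
end

section
/- (Structure of the negativity set of α, asserted in the proof of Lemma 2.2.) Assume 0<k<k_c, i.e. σ₋k²<g⟦ρ⟧. Then there exists s*>0 such that the set {s>0 : α(k,s)<0} equals the open interval (0,s*). -/
open MeasureTheory Set

theorem aux_pw_integrable (vm vp a c : ℝ) : IntervalIntegrable (pw vm vp) volume a c := by
  have hm : Measurable (pw vm vp) :=
    Measurable.ite measurableSet_Iio measurable_const measurable_const
  have hc : IntervalIntegrable (fun _ : ℝ => |vm| + |vp|) volume a c :=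
    intervalIntegrable_const
  refine hc.mono_fun hm.aestronglyMeasurable (Filter.Eventually.of_forall fun x => ?_)
  simp only [pw, Real.norm_eq_abs]
  rw [abs_of_nonneg (by positivity : 0 ≤ |vm| + |vp|)]
  split_ifs
  · linarith [abs_nonneg vp]
  · linarith [abs_nonneg vm]

theorem aux_pw_mono (b vm vp v : ℝ) (hb : 0 < b) (h1 : v ≤ vm) (h2 : v ≤ vp) (hv : 0 ≤ v)
    (D F : ℝ → ℝ) (hD : ContinuousOn D (Icc (-b) 1)) (hF : ContinuousOn F (Icc (-b) 1))
    (hD0 : ∀ x, 0 ≤ D x) (hDF : ∀ x, D x ≤ F x) :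
    v * ∫ x in (-b)..1, D x ≤ ∫ x in (-b)..1, pw vm vp x * F x := by
  have hle : -b ≤ 1 := by linarith
  rw [← intervalIntegral.integral_const_mul]
  have hI : IntervalIntegrable D volume (-b) 1 :=
    ContinuousOn.intervalIntegrable (by rwa [uIcc_of_le hle])
  refine intervalIntegral.integral_mono_on hle (hI.const_mul v)
    ((aux_pw_integrable vm vp _ _).mul_continuousOn (by rwa [uIcc_of_le hle])) fun x _ => ?_
  have hp : v ≤ pw vm vp x := by
    unfold pw
    split_ifs <;> assumption
  exact mul_le_mul hp (hDF x) (hD0 x) (hv.trans hp)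

theorem aux_d1_cont (b : ℝ) (hb : 0 < b) (ψ : ℝ → ℝ) (h : memA b ψ) :
    ContinuousOn (d1 b ψ) (Icc (-b) 1) :=
  h.1.continuousOn_derivWithin (uniqueDiffOn_Icc (by linarith)) (by norm_num)

theorem aux_d2_cont (b : ℝ) (hb : 0 < b) (ψ : ℝ → ℝ) (h : memA b ψ) :
    ContinuousOn (d2 b ψ) (Icc (-b) 1) := by
  have hu : UniqueDiffOn ℝ (Icc (-b) 1) := uniqueDiffOn_Icc (by linarith)
  have h1 : ContDiffOn ℝ 1 (d1 b ψ) (Icc (-b) 1) := h.1.derivWithin hu (by norm_num)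
  exact h1.continuousOn_derivWithin hu (by norm_num)

theorem aux_psi0 (b : ℝ) (hb : 0 < b) (ψ : ℝ → ℝ) (h : memA b ψ) :
    ψ 0 ^ 2 ≤ b * ∫ x in (-b)..1, d1 b ψ x ^ 2 := by
  have hc := aux_d1_cont b hb ψ h
  have hsub : Icc (-b) 0 ⊆ Icc (-b) 1 := Icc_subset_Icc_right (by norm_num)
  have hle : -b ≤ 0 := by linarith
  have hc0 : ContinuousOn (d1 b ψ) (uIcc (-b) 0) := by
    rw [uIcc_of_le hle]; exact hc.mono hsub
  have hF : ∫ x in (-b)..0, d1 b ψ x = ψ 0 := by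
    rw [intervalIntegral.integral_eq_sub_of_hasDerivAt_of_le hle
      (h.1.continuousOn.mono hsub) (fun x hx => ?_) hc0.intervalIntegrable, h.2.1, sub_zero]
    have hx1 : x ∈ Icc (-b) 1 := ⟨hx.1.le, by linarith [hx.2]⟩
    exact ((h.1.differentiableOn (by norm_num)) x hx1).hasDerivWithinAt.hasDerivAt
      (Icc_mem_nhds hx.1 (by linarith [hx.2]))
  have hi1 : IntervalIntegrable (fun x => d1 b ψ x ^ 2) volume (-b) 0 :=
    (hc0.pow 2).intervalIntegrable
  have hi2 : IntervalIntegrable (fun x => d1 b ψ x ^ 2) volume 0 1 :=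
    ContinuousOn.intervalIntegrable (by
      rw [uIcc_of_le zero_le_one]
      exact (hc.mono (Icc_subset_Icc_left hle)).pow 2)
  have hadd := intervalIntegral.integral_add_adjacent_intervals hi1 hi2
  have hpos : 0 ≤ ∫ x in (0:ℝ)..1, d1 b ψ x ^ 2 :=
    intervalIntegral.integral_nonneg zero_le_one fun x _ => sq_nonneg _
  set m := ψ 0 / b with hm
  have hmono : ∫ x in (-b)..0, (2 * m * d1 b ψ x - m ^ 2) ≤ ∫ x in (-b)..0, d1 b ψ x ^ 2 := by
    refine intervalIntegral.integral_mono_on hle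
      ((hc0.intervalIntegrable.const_mul _).sub intervalIntegrable_const) hi1 fun x _ => ?_
    nlinarith [sq_nonneg (d1 b ψ x - m)]
  rw [intervalIntegral.integral_sub (hc0.intervalIntegrable.const_mul _)
    intervalIntegrable_const, intervalIntegral.integral_const_mul, hF,
    intervalIntegral.integral_const] at hmono
  have hmb : ψ 0 = m * b := by rw [hm]; field_simp
  rw [← hadd]
  simp only [smul_eq_mul] at hmono
  rw [hmb] at hmono ⊢
  nlinarith

theorem aux_J (b ρm ρp k : ℝ) (hb : 0 < b) (hρm : 0 < ρm) (hρ : ρm < ρp)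
    (ψ : ℝ → ℝ) (h : memA b ψ) : ρm * ψ 0 ^ 2 ≤ 2 * b * Jen b ρm ρp k ψ := by
  have hc := aux_d1_cont b hb ψ h
  have h0 := aux_psi0 b hb ψ h
  have := aux_pw_mono b ρm ρp ρm hb le_rfl hρ.le hρm.le (fun x => d1 b ψ x ^ 2)
    (fun x => k ^ 2 * ψ x ^ 2 + d1 b ψ x ^ 2) (hc.pow 2)
    ((continuousOn_const.mul (h.1.continuousOn.pow 2)).add (hc.pow 2))
    (fun x => sq_nonneg _) (fun x => by nlinarith [sq_nonneg (k * ψ x)])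
  unfold Jen
  nlinarith [mul_le_mul_of_nonneg_left h0 hρm.le, mul_le_mul_of_nonneg_left this hb.le]

theorem aux_E1 (b μm μp k : ℝ) (hb : 0 < b) (hμm : 0 < μm) (hμp : 0 < μp)
    (ψ : ℝ → ℝ) (h : memA b ψ) :
    2 * k ^ 2 * min μm μp * ψ 0 ^ 2 ≤ b * E1 b μm μp k ψ := by
  have hc := aux_d1_cont b hb ψ h
  have hc2 := aux_d2_cont b hb ψ h
  have h0 := aux_psi0 b hb ψ h
  have hv : 0 < min μm μp := lt_min hμm hμp
  have := aux_pw_mono b μm μp (min μm μp) hb (min_le_left _ _) (min_le_right _ _) hv.le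
    (fun x => 4 * k ^ 2 * d1 b ψ x ^ 2)
    (fun x => 4 * k ^ 2 * d1 b ψ x ^ 2 + (k ^ 2 * ψ x + d2 b ψ x) ^ 2)
    (continuousOn_const.mul (hc.pow 2))
    ((continuousOn_const.mul (hc.pow 2)).add
      (((continuousOn_const.mul h.1.continuousOn).add hc2).pow 2))
    (fun x => by positivity) (fun x => by nlinarith [sq_nonneg (k ^ 2 * ψ x + d2 b ψ x)])
  rw [intervalIntegral.integral_const_mul] at this
  unfold E1
  have h3 : 0 ≤ 2 * k ^ 2 * min μm μp := by positivity
  nlinarith [mul_le_mul_of_nonneg_left h0 h3, mul_le_mul_of_nonneg_left this hb.le]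

theorem aux_exists (b ρm ρp k : ℝ) (hb : 0 < b) (hρm : 0 < ρm) (hρ : ρm < ρp) :
    ∃ ψ : ℝ → ℝ, memA b ψ ∧ Jen b ρm ρp k ψ = 1 ∧ ψ 0 ≠ 0 ∧ ψ 1 = 0 := by
  have hA : ∀ c : ℝ, memA b (fun x => c * ((x + b) ^ 2 * (x - 1))) := by
    intro c
    refine ⟨ContDiff.contDiffOn (by fun_prop), by ring, ?_⟩
    have hd : HasDerivAt (fun x : ℝ => c * ((x + b) ^ 2 * (x - 1))) 0 (-b) := by
      have h1 : HasDerivAt (fun x : ℝ => x + b) 1 (-b) := (hasDerivAt_id _).add_const b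
      have h2 : HasDerivAt (fun x : ℝ => x - 1) 1 (-b) := (hasDerivAt_id _).sub_const 1
      exact (((h1.pow 2).mul h2).const_mul c).congr_deriv (by simp)
    exact hd.hasDerivWithinAt.derivWithin
      ((uniqueDiffOn_Icc (by linarith)) _ ⟨le_rfl, by linarith⟩)
  set φ : ℝ → ℝ := fun x => (x + b) ^ 2 * (x - 1) with hφ
  have hJs : ∀ c : ℝ, Jen b ρm ρp k (fun x => c * φ x) = c ^ 2 * Jen b ρm ρp k φ := by
    intro c
    have hd : ∀ x, d1 b (fun x => c * φ x) x = c * d1 b φ x := by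
      intro x
      unfold d1
      exact derivWithin_const_mul_field c
    unfold Jen
    simp only [hd]
    have hI : ∫ x in (-b)..1, pw ρm ρp x * (k ^ 2 * (c * φ x) ^ 2 + (c * d1 b φ x) ^ 2)
        = c ^ 2 * ∫ x in (-b)..1, pw ρm ρp x * (k ^ 2 * φ x ^ 2 + d1 b φ x ^ 2) := by
      rw [← intervalIntegral.integral_const_mul]
      congr 1
      ext x
      ring
    rw [hI]
    ring
  have hφA : memA b φ := by simpa using hA 1
  have hpos : 0 < Jen b ρm ρp k φ := by
    have := aux_J b ρm ρp k hb hρm hρ φ hφA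
    have h0 : φ 0 = - b ^ 2 := by simp [hφ]
    rw [h0] at this
    have h4 : 0 < ρm * (-b ^ 2) ^ 2 := by
      rw [neg_sq]; positivity
    by_contra hn
    push Not at hn
    nlinarith
  refine ⟨fun x => (Real.sqrt (Jen b ρm ρp k φ))⁻¹ * φ x, hA _, ?_, ?_, ?_⟩
  · rw [hJs, inv_pow, Real.sq_sqrt hpos.le, inv_mul_cancel₀ hpos.ne']
  · have : Real.sqrt (Jen b ρm ρp k φ) ≠ 0 := (Real.sqrt_pos.2 hpos).ne'
    have h0 : φ 0 ≠ 0 := by simp [hφ, hb.ne']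
    exact mul_ne_zero (inv_ne_zero this) h0
  · simp [hφ]

/-- Structure of the negativity set of `α` (from the proof of Lemma 2.2): in the
subcritical regime the set `{s > 0 : α(k,s) < 0}` is an open interval `(0, s*)`. -/
theorem alpha_negativity_set
    (b g ρm ρp μm μp σm σp k : ℝ)
    (hb : 0 < b) (hg : 0 < g) (hρm : 0 < ρm) (hρ : ρm < ρp)
    (hμm : 0 < μm) (hμp : 0 < μp) (hσm : 0 ≤ σm) (hσp : 0 ≤ σp) (hk : 0 < k)
    (hsub : σm * k ^ 2 < g * (ρp - ρm)) :
    ∃ sstar : ℝ, 0 < sstar ∧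
      {s : ℝ | 0 < s ∧ alpha b g ρm ρp μm μp σm σp k s < 0} = Set.Ioo 0 sstar := by
  have hδ : 0 < g * (ρp - ρm) - σm * k ^ 2 := by linarith
  set δ := g * (ρp - ρm) - σm * k ^ 2 with hδd
  have hρp : 0 < ρp := hρm.trans hρ
  have hP : 0 ≤ σp * k ^ 2 + g * ρp := by positivity
  have hE0 : ∀ ψ : ℝ → ℝ, -(k ^ 2 / 2 * δ * ψ 0 ^ 2) ≤ E0 b g ρm ρp σm σp k ψ := by
    intro ψ
    have : 0 ≤ k ^ 2 / 2 * (σp * k ^ 2 + g * ρp) * ψ 1 ^ 2 := by positivity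
    unfold E0
    rw [hδd]
    nlinarith
  have hm : 0 < min μm μp := lt_min hμm hμp
  have hE1 : ∀ ψ : ℝ → ℝ, memA b ψ → 0 ≤ E1 b μm μp k ψ := by
    intro ψ h
    have h1 := aux_E1 b μm μp k hb hμm hμp ψ h
    have h2 : 0 ≤ 2 * k ^ 2 * min μm μp * ψ 0 ^ 2 := by positivity
    exact nonneg_of_mul_nonneg_right (h2.trans h1) hb
  have hiff : ∀ s : ℝ, 0 < s → (alpha b g ρm ρp μm μp σm σp k s < 0 ↔
      ∃ ψ : ℝ → ℝ, (memA b ψ ∧ Jen b ρm ρp k ψ = 1) ∧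
        s * E1 b μm μp k ψ + E0 b g ρm ρp σm σp k ψ < 0) := by
    intro s hs
    constructor
    · intro h
      by_contra hn
      push Not at hn
      refine absurd h (not_lt.2 (Real.sInf_nonneg ?_))
      rintro _ ⟨ψ, hψ, rfl⟩
      exact hn ψ hψ
    · rintro ⟨ψ, hψ, hlt⟩
      refine lt_of_le_of_lt (csInf_le ⟨-(k ^ 2 / 2 * δ * (2 * b / ρm)), ?_⟩ ⟨ψ, hψ, rfl⟩) hlt
      rintro _ ⟨φ, hφ, rfl⟩
      have h1 := aux_J b ρm ρp k hb hρm hρ φ hφ.1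
      rw [hφ.2, mul_one] at h1
      have h2 : φ 0 ^ 2 ≤ 2 * b / ρm := by
        rw [le_div_iff₀ hρm]; linarith
      have h3 : k ^ 2 / 2 * δ * φ 0 ^ 2 ≤ k ^ 2 / 2 * δ * (2 * b / ρm) :=
        mul_le_mul_of_nonneg_left h2 (by positivity)
      have h4 := mul_nonneg hs.le (hE1 φ hφ.1)
      have h5 := hE0 φ
      unfold En
      linarith
  set N : Set ℝ := {s : ℝ | 0 < s ∧ alpha b g ρm ρp μm μp σm σp k s < 0} with hN
  have hbdd : BddAbove N := by
    refine ⟨δ * b / (4 * min μm μp), ?_⟩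
    rintro s ⟨hs, ha⟩
    obtain ⟨ψ, hψ, hlt⟩ := (hiff s hs).1 ha
    have h1 := aux_E1 b μm μp k hb hμm hμp ψ hψ.1
    have h2 := hE0 ψ
    by_contra hn
    push Not at hn
    rw [div_lt_iff₀ (by positivity)] at hn
    have h3 := mul_le_mul_of_nonneg_left h1 hs.le
    have h4 : 0 ≤ k ^ 2 / 2 * ψ 0 ^ 2 := by positivity
    have h5 := mul_le_mul_of_nonneg_left hn.le h4
    have h6 : b * (s * E1 b μm μp k ψ + E0 b g ρm ρp σm σp k ψ) < 0 :=
      mul_neg_of_pos_of_neg hb hlt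
    have h7 := mul_le_mul_of_nonneg_left h2 hb.le
    nlinarith
  have hdown : ∀ s ∈ N, ∀ t, 0 < t → t ≤ s → t ∈ N := by
    rintro s ⟨hs, ha⟩ t ht hts
    obtain ⟨ψ, hψ, hlt⟩ := (hiff s hs).1 ha
    refine ⟨ht, (hiff t ht).2 ⟨ψ, hψ, ?_⟩⟩
    have := mul_le_mul_of_nonneg_right hts (hE1 ψ hψ.1)
    linarith
  have hup : ∀ s, 0 ≤ s → (∃ ψ : ℝ → ℝ, (memA b ψ ∧ Jen b ρm ρp k ψ = 1) ∧
        s * E1 b μm μp k ψ + E0 b g ρm ρp σm σp k ψ < 0) → ∃ t ∈ N, s < t := by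
    rintro s hs ⟨ψ, hψ, hlt⟩
    have he := hE1 ψ hψ.1
    set e := E1 b μm μp k ψ with hed
    set X := s * e + E0 b g ρm ρp σm σp k ψ with hX
    have hq : 0 < -X / (e + 1) := by
      apply div_pos <;> linarith
    refine ⟨s + -X / (e + 1), ⟨by linarith, (hiff _ (by linarith)).2 ⟨ψ, hψ, ?_⟩⟩, by linarith⟩
    have h1 : -X / (e + 1) * (e + 1) = -X := div_mul_cancel₀ _ (by linarith)
    rw [← hed]
    nlinarith
  obtain ⟨ψ, hψ, hJ, hψ0, hψ1⟩ := aux_exists b ρm ρp k hb hρm hρ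
  obtain ⟨t, htN, ht⟩ := hup 0 le_rfl ⟨ψ, ⟨hψ, hJ⟩, by
    have : 0 < k ^ 2 / 2 * δ * ψ 0 ^ 2 := by positivity
    unfold E0
    rw [hψ1]
    rw [hδd] at this
    nlinarith⟩
  refine ⟨sSup N, ht.trans_le (le_csSup hbdd htN), ?_⟩
  ext s
  constructor
  · intro hs
    obtain ⟨t', ht'N, ht'⟩ := hup s hs.1.le ((hiff s hs.1).1 hs.2)
    exact ⟨hs.1, ht'.trans_le (le_csSup hbdd ht'N)⟩
  · rintro ⟨hs, hlt⟩
    obtain ⟨r, hr, hsr⟩ := exists_lt_of_lt_csSup ⟨t, htN⟩ hlt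
    exact hdown r hr s hs hsr.le
end

section
/- (Variational characterization of the largest growth rate, used in the proof of Lemma 2.6.) Fix k>0 and let Λ>0 be such that every s>0 with α(k,s)=−s² satisfies s ≤ Λ. Then ΛE1(ψ;k)+E0(ψ;k) ≥ −Λ²J(ψ;k) for every ψ∈𝒜, i.e. E(ψ;k,Λ) ≥ −Λ²J(ψ;k). -/
open MeasureTheory Set

lemma pw_integrable (vm vp a c : ℝ) (F : ℝ → ℝ) (hac : a ≤ c) (hF : ContinuousOn F (Icc a c)) :
    IntervalIntegrable (fun x => pw vm vp x * F x) volume a c := by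
  have hFi : IntegrableOn F (Ioc a c) volume :=
    (hF.integrableOn_Icc).mono_set Ioc_subset_Icc_self
  rw [intervalIntegrable_iff_integrableOn_Ioc_of_le hac]
  have hm : Measurable (pw vm vp) := by
    unfold pw
    exact Measurable.ite measurableSet_Iio measurable_const measurable_const
  refine Integrable.bdd_mul (c := max |vm| |vp|) hFi hm.aestronglyMeasurable ?_
  refine Filter.Eventually.of_forall fun x => ?_
  unfold pw
  split_ifs <;> simp

lemma Jen_nonneg (b ρm ρp k : ℝ) (hb : 0 < b) (hρm : 0 < ρm) (hρp : 0 < ρp) (ψ : ℝ → ℝ) :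
    0 ≤ Jen b ρm ρp k ψ := by
  unfold Jen
  refine mul_nonneg (by norm_num) (intervalIntegral.integral_nonneg (by linarith) fun x _ => ?_)
  have : 0 < pw ρm ρp x := by unfold pw; split_ifs <;> assumption
  positivity

lemma psi0_bound (b ρm ρp k : ℝ) (hb : 0 < b) (hρm : 0 < ρm) (hρ : ρm < ρp) (hk : 0 < k)
    (ψ : ℝ → ℝ) (hψ : memA b ψ) : k * ρm * ψ 0 ^ 2 ≤ 2 * Jen b ρm ρp k ψ := by
  obtain ⟨hc, h0, -⟩ := hψ
  have hu : UniqueDiffOn ℝ (Icc (-b) 1) := uniqueDiffOn_Icc (by linarith)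
  have hψc : ContinuousOn ψ (Icc (-b) 1) := hc.continuousOn
  have hdc : ContinuousOn (d1 b ψ) (Icc (-b) 1) :=
    hc.continuousOn_derivWithin hu (by norm_num)
  have hsub : Icc (-b) 0 ⊆ Icc (-b) 1 := Icc_subset_Icc le_rfl (by norm_num)
  have hder : ∀ x ∈ Ioo (-b) 0, HasDerivAt (fun y => ψ y ^ 2) (2 * ψ x * d1 b ψ x) x := by
    intro x hx
    have hn : Icc (-b) 1 ∈ nhds x := Icc_mem_nhds hx.1 (by linarith [hx.2])
    have hd : HasDerivAt ψ (d1 b ψ x) x :=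
      ((hc.differentiableOn (by norm_num) x
        (hsub (Ioo_subset_Icc_self hx))).hasDerivWithinAt).hasDerivAt hn
    have h2 := hd.pow 2
    have e : ((2 : ℕ) : ℝ) * ψ x ^ (2 - 1) * d1 b ψ x = 2 * ψ x * d1 b ψ x := by norm_num
    rw [e] at h2
    exact h2
  have hb0 : -b ≤ 0 := by linarith
  have hi1 : ContinuousOn (fun x => 2 * ψ x * d1 b ψ x) (Icc (-b) 0) :=
    ((continuousOn_const.mul hψc).mul hdc).mono hsub
  have hFc : ContinuousOn (fun x => k ^ 2 * ψ x ^ 2 + d1 b ψ x ^ 2) (Icc (-b) 1) :=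
    (continuousOn_const.mul (hψc.pow 2)).add (hdc.pow 2)
  have ftc := intervalIntegral.integral_eq_sub_of_hasDerivAt_of_le hb0
    ((hψc.pow 2).mono hsub) hder (hi1.intervalIntegrable_of_Icc hb0)
  have s1 : k * ψ 0 ^ 2 ≤ ∫ x in (-b)..0, (k ^ 2 * ψ x ^ 2 + d1 b ψ x ^ 2) := by
    have : k * ψ 0 ^ 2 = ∫ x in (-b)..0, k * (2 * ψ x * d1 b ψ x) := by
      rw [intervalIntegral.integral_const_mul, ftc]; simp [h0]
    rw [this]
    refine intervalIntegral.integral_mono_on hb0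
      ((continuousOn_const.mul hi1).intervalIntegrable_of_Icc hb0)
      ((hFc.mono hsub).intervalIntegrable_of_Icc hb0) fun x _ => ?_
    nlinarith [sq_nonneg (k * ψ x - d1 b ψ x)]
  have hFi : IntervalIntegrable (fun x => k ^ 2 * ψ x ^ 2 + d1 b ψ x ^ 2) volume (-b) 1 :=
    hFc.intervalIntegrable_of_Icc (by linarith)
  have s2 : ∫ x in (-b)..0, (k ^ 2 * ψ x ^ 2 + d1 b ψ x ^ 2)
      ≤ ∫ x in (-b)..1, (k ^ 2 * ψ x ^ 2 + d1 b ψ x ^ 2) :=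
    intervalIntegral.integral_mono_interval le_rfl hb0 (by norm_num)
      (Filter.Eventually.of_forall fun x => by simp only [Pi.zero_apply]; positivity) hFi
  have s3 : ρm * ∫ x in (-b)..1, (k ^ 2 * ψ x ^ 2 + d1 b ψ x ^ 2)
      ≤ ∫ x in (-b)..1, pw ρm ρp x * (k ^ 2 * ψ x ^ 2 + d1 b ψ x ^ 2) := by
    rw [← intervalIntegral.integral_const_mul]
    refine intervalIntegral.integral_mono_on (by linarith) (hFi.const_mul _)
      (pw_integrable _ _ _ _ _ (by linarith) hFc) fun x _ => ?_
    refine mul_le_mul_of_nonneg_right ?_ (by positivity)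
    unfold pw; split_ifs <;> linarith
  unfold Jen
  have s4 := mul_le_mul_of_nonneg_left (s1.trans s2) hρm.le
  linarith

lemma d1_smul (b c : ℝ) (ψ : ℝ → ℝ) : d1 b (fun x => c * ψ x) = fun x => c * d1 b ψ x := by
  funext x
  exact derivWithin_const_mul_field c

lemma d2_smul (b c : ℝ) (ψ : ℝ → ℝ) : d2 b (fun x => c * ψ x) = fun x => c * d2 b ψ x := by
  funext x
  unfold d2
  rw [d1_smul]
  exact derivWithin_const_mul_field c

lemma E1_smul (b μm μp k c : ℝ) (ψ : ℝ → ℝ) :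
    E1 b μm μp k (fun x => c * ψ x) = c ^ 2 * E1 b μm μp k ψ := by
  unfold E1
  rw [d1_smul, d2_smul, mul_left_comm (c ^ 2), ← intervalIntegral.integral_const_mul (c ^ 2)]
  congr 2; funext x; ring

lemma En_smul (b g ρm ρp μm μp σm σp k s c : ℝ) (ψ : ℝ → ℝ) :
    En b g ρm ρp μm μp σm σp k s (fun x => c * ψ x)
      = c ^ 2 * En b g ρm ρp μm μp σm σp k s ψ := by
  unfold En E0
  rw [E1_smul]; ring

lemma memA_smul (b c : ℝ) (ψ : ℝ → ℝ) (h : memA b ψ) : memA b (fun x => c * ψ x) := by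
  refine ⟨contDiffOn_const.mul h.1, by simp [h.2.1], ?_⟩
  rw [d1_smul]; simp [h.2.2]

lemma E0_bound (b g ρm ρp σm σp k : ℝ)
    (hb : 0 < b) (hg : 0 < g) (hρm : 0 < ρm) (hρ : ρm < ρp)
    (hσm : 0 ≤ σm) (hσp : 0 ≤ σp) (hk : 0 < k) (ψ : ℝ → ℝ) (hψ : memA b ψ) :
    -(k * g * (ρp - ρm) / ρm) * Jen b ρm ρp k ψ ≤ E0 b g ρm ρp σm σp k ψ := by
  have h := psi0_bound b ρm ρp k hb hρm hρ hk ψ hψ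
  have hρp : 0 < ρp := hρm.trans hρ
  have hd : 0 < ρp - ρm := by linarith
  have h1 : k ^ 2 / 2 * (g * (ρp - ρm)) * ψ 0 ^ 2
      ≤ k * g * (ρp - ρm) / ρm * Jen b ρm ρp k ψ := by
    have := mul_le_mul_of_nonneg_left h (show 0 ≤ k * g * (ρp - ρm) / (2 * ρm) by positivity)
    calc _ = k * g * (ρp - ρm) / (2 * ρm) * (k * ρm * ψ 0 ^ 2) := by field_simp
      _ ≤ _ := this
      _ = _ := by field_simp
  have h2 : 0 ≤ k ^ 2 / 2 * (σp * k ^ 2 + g * ρp) * ψ 1 ^ 2 := by positivity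
  have h3 : 0 ≤ k ^ 2 / 2 * (σm * k ^ 2) * ψ 0 ^ 2 := by positivity
  unfold E0
  linarith

/-- Variational characterization of the largest growth rate (used in the proof of
Lemma 2.6): if every fixed point `s > 0` of `α(k,s) = -s²` satisfies `s ≤ Λ`, then
`E(ψ;k,Λ) ≥ -Λ² J(ψ;k)` for every `ψ ∈ 𝒜`. -/
theorem variational_characterization
    (b g ρm ρp μm μp σm σp k Λ : ℝ)
    (hb : 0 < b) (hg : 0 < g) (hρm : 0 < ρm) (hρ : ρm < ρp)
    (hμm : 0 < μm) (hμp : 0 < μp) (hσm : 0 ≤ σm) (hσp : 0 ≤ σp) (hk : 0 < k)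
    (hΛ : 0 < Λ)
    (hmax : ∀ s : ℝ, 0 < s → alpha b g ρm ρp μm μp σm σp k s = -(s ^ 2) → s ≤ Λ) :
    ∀ ψ : ℝ → ℝ, memA b ψ →
      -(Λ ^ 2) * Jen b ρm ρp k ψ ≤ En b g ρm ρp μm μp σm σp k Λ ψ := by
  intro ψ hψ
  by_contra hlt
  push Not at hlt
  have hρp : 0 < ρp := hρm.trans hρ
  set C : ℝ := k * g * (ρp - ρm) / ρm with hC
  have hC0 : 0 ≤ C := by
    have : 0 < ρp - ρm := by linarith
    positivity
  have hE1 : ∀ φ, 0 ≤ E1 b μm μp k φ := E1_nonneg b μm μp k hb hμm hμp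
  have hE0 : ∀ φ, memA b φ → -C * Jen b ρm ρp k φ ≤ E0 b g ρm ρp σm σp k φ :=
    E0_bound b g ρm ρp σm σp k hb hg hρm hρ hσm hσp hk
  have hJ : 0 < Jen b ρm ρp k ψ := by
    rcases (Jen_nonneg b ρm ρp k hb hρm hρp ψ).lt_or_eq with h | h
    · exact h
    · exfalso
      have h1 := hE0 ψ hψ
      have h2 := mul_nonneg hΛ.le (hE1 ψ)
      unfold En at hlt
      rw [← h] at h1 hlt
      linarith
  have hlow : ∀ s, 0 ≤ s → ∀ y ∈ enSet b g ρm ρp μm μp σm σp k s, -C ≤ y := by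
    rintro s hs y ⟨φ, ⟨hφ, hJφ⟩, rfl⟩
    have h1 := hE0 φ hφ
    have h2 := mul_nonneg hs (hE1 φ)
    rw [hJφ] at h1
    unfold En
    linarith
  have hbdd : ∀ s, 0 ≤ s → BddBelow (enSet b g ρm ρp μm μp σm σp k s) :=
    fun s hs => ⟨-C, fun y hy => hlow s hs y hy⟩
  set c : ℝ := (Real.sqrt (Jen b ρm ρp k ψ))⁻¹ with hc
  have hc2 : c ^ 2 = (Jen b ρm ρp k ψ)⁻¹ := by
    rw [hc, inv_pow, Real.sq_sqrt hJ.le]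
  have hmem : ∀ s, En b g ρm ρp μm μp σm σp k s (fun x => c * ψ x)
      ∈ enSet b g ρm ρp μm μp σm σp k s := by
    intro s
    refine ⟨_, ⟨memA_smul b c ψ hψ, ?_⟩, rfl⟩
    rw [Jen_smul, hc2, inv_mul_cancel₀ hJ.ne']
  have hne : ∀ s, (enSet b g ρm ρp μm μp σm σp k s).Nonempty := fun s => ⟨_, hmem s⟩
  have hαlow : ∀ s, 0 ≤ s → -C ≤ alpha b g ρm ρp μm μp σm σp k s :=
    fun s hs => le_csInf (hne s) (hlow s hs)
  have hαΛ : alpha b g ρm ρp μm μp σm σp k Λ < -(Λ ^ 2) := by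
    refine (csInf_le (hbdd Λ hΛ.le) (hmem Λ)).trans_lt ?_
    rw [En_smul, hc2, inv_mul_lt_iff₀ hJ]
    linarith
  have hconc : ConcaveOn ℝ (Ioi 0) (alpha b g ρm ρp μm μp σm σp k) := by
    refine ⟨convex_Ioi 0, ?_⟩
    intro s hs t ht p q hp hq hpq
    simp only [smul_eq_mul]
    refine le_csInf (hne _) ?_
    rintro y ⟨φ, hφ, rfl⟩
    have h1 := csInf_le (hbdd s (le_of_lt hs)) ⟨φ, hφ, rfl⟩
    have h2 := csInf_le (hbdd t (le_of_lt ht)) ⟨φ, hφ, rfl⟩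
    have h1' := mul_le_mul_of_nonneg_left h1 hp
    have h2' := mul_le_mul_of_nonneg_left h2 hq
    have : En b g ρm ρp μm μp σm σp k (p * s + q * t) φ
        = p * En b g ρm ρp μm μp σm σp k s φ + q * En b g ρm ρp μm μp σm σp k t φ := by
      unfold En
      linear_combination (-(E0 b g ρm ρp σm σp k φ)) * hpq
    rw [this]
    exact add_le_add h1' h2'
  have hcont : ContinuousOn (alpha b g ρm ρp μm μp σm σp k) (Ioi 0) :=
    hconc.continuousOn isOpen_Ioi
  have hT : Λ ≤ Λ + C + 1 := by linarith
  have hcont2 : ContinuousOn (fun s => alpha b g ρm ρp μm μp σm σp k s + s ^ 2)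
      (Icc Λ (Λ + C + 1)) :=
    (hcont.mono fun x hx => lt_of_lt_of_le hΛ hx.1).add (continuousOn_id.pow 2)
  have h0mem : (0 : ℝ) ∈ Icc (alpha b g ρm ρp μm μp σm σp k Λ + Λ ^ 2)
      (alpha b g ρm ρp μm μp σm σp k (Λ + C + 1) + (Λ + C + 1) ^ 2) := by
    refine ⟨by linarith, ?_⟩
    have := hαlow (Λ + C + 1) (by linarith)
    nlinarith
  obtain ⟨s, hs, hs0⟩ := intermediate_value_Icc hT hcont2 h0mem
  simp only at hs0
  have hsΛ : s = Λ :=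
    le_antisymm (hmax s (lt_of_lt_of_le hΛ hs.1) (by linarith)) hs.1
  rw [hsΛ] at hs0
  linarith
end
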